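/- arXiv:2406.18033 — 2 statements merged into one kernel-verified Lean document; each statement's English description precedes it below -/
import Mathlib

section
/- (Consequence of Theorem 1) For any function Q : S → A → ℝ and all (s,a): |Q*(s,a) − (B Q)(s,a)| ≤ (γ/(1−γ)) · max_{(s̄,ā)} |Δ_Q(s̄,ā)|, i.e. a single soft Bellman iterate applied to an arbitrary input function is within H·γ·‖Δ_Q‖_∞ of the optimal value function, where H = 1/(1−γ). -/
open Real

/-- The soft (entropy-regularized) Bellman operator for a finite MDP. -/
noncomputable def softBellman {S A : Type*} [Fintype S] [Fintype A]
    (p : S → A → PMF S) (r : S → A → ℝ) (γ β : ℝ) (π0 : S → PMF A)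
    (Q : S → A → ℝ) : S → A → ℝ :=
  fun s a => r s a + (γ / β) * ∑ s' : S, (p s a s').toReal *
      Real.log (∑ a' : A, (π0 s' a').toReal * Real.exp (β * Q s' a'))

/-- The soft state-value function of `Q`. -/
noncomputable def softV {S A : Type*} [Fintype A]
    (β : ℝ) (π0 : S → PMF A) (Q : S → A → ℝ) (s : S) : ℝ :=
  (1 / β) * Real.log (∑ a : A, (π0 s a).toReal * Real.exp (β * Q s a))

/-- The soft Bellman residual of `Q`. -/
noncomputable def softDelta {S A : Type*} [Fintype S] [Fintype A]
    (p : S → A → PMF S) (r : S → A → ℝ) (γ β : ℝ) (π0 : S → PMF A)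
    (Q : S → A → ℝ) (s : S) (a : A) : ℝ :=
  r s a + γ * ∑ s' : S, (p s a s').toReal * softV β π0 Q s' - Q s a

theorem pmf_sum_toReal {S : Type*} [Fintype S] (q : PMF S) : ∑ s, (q s).toReal = 1 := by
  rw [← ENNReal.toReal_sum (fun s _ => q.apply_ne_top s), ← tsum_fintype (L := .unconditional S), q.tsum_coe]
  simp

theorem softBellman_le {S A : Type*} [Fintype S] [Fintype A] [Nonempty A]
    (p : S → A → PMF S) (r : S → A → ℝ) (γ β : ℝ) (π0 : S → PMF A)
    (hγ0 : 0 ≤ γ) (hβ : 0 < β) (hπ0 : ∀ s a, 0 < π0 s a)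
    (Q1 Q2 : S → A → ℝ) (d : ℝ) (h : ∀ s a, Q1 s a ≤ Q2 s a + d) (s : S) (a : A) :
    softBellman p r γ β π0 Q1 s a ≤ softBellman p r γ β π0 Q2 s a + γ * d := by
  have hpos : ∀ (Q : S → A → ℝ) s', 0 < ∑ a' : A, (π0 s' a').toReal * Real.exp (β * Q s' a') := by
    intro Q s'
    refine Finset.sum_pos (fun a' _ => ?_) Finset.univ_nonempty
    exact mul_pos (ENNReal.toReal_pos (hπ0 s' a').ne' ((π0 s').apply_ne_top a')) (Real.exp_pos _)
  have hlog : ∀ s', Real.log (∑ a' : A, (π0 s' a').toReal * Real.exp (β * Q1 s' a')) ≤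
      Real.log (∑ a' : A, (π0 s' a').toReal * Real.exp (β * Q2 s' a')) + β * d := by
    intro s'
    rw [← Real.log_exp (β * d), ← Real.log_mul (hpos Q2 s').ne' (Real.exp_pos _).ne']
    refine Real.log_le_log (hpos Q1 s') ?_
    rw [Finset.sum_mul]
    refine Finset.sum_le_sum (fun a' _ => ?_)
    rw [mul_assoc, ← Real.exp_add, ← mul_add]
    exact mul_le_mul_of_nonneg_left
      (Real.exp_le_exp.2 (mul_le_mul_of_nonneg_left (h s' a') hβ.le)) ENNReal.toReal_nonneg
  have hsum := Finset.sum_le_sum (s := Finset.univ) (fun s' _ =>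
    mul_le_mul_of_nonneg_left (hlog s') (ENNReal.toReal_nonneg (a := p s a s')))
  simp only [mul_add, Finset.sum_add_distrib] at hsum
  rw [← Finset.sum_mul, pmf_sum_toReal, one_mul] at hsum
  have h2 := mul_le_mul_of_nonneg_left hsum (div_nonneg hγ0 hβ.le)
  have h3 : γ / β * (β * d) = γ * d := by field_simp
  rw [mul_add, h3] at h2
  unfold softBellman
  linarith

theorem softDelta_eq {S A : Type*} [Fintype S] [Fintype A]
    (p : S → A → PMF S) (r : S → A → ℝ) (γ β : ℝ) (π0 : S → PMF A)
    (Q : S → A → ℝ) (s : S) (a : A) :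
    softDelta p r γ β π0 Q s a = softBellman p r γ β π0 Q s a - Q s a := by
  unfold softDelta softBellman softV
  congr 2
  rw [Finset.mul_sum, Finset.mul_sum]
  refine Finset.sum_congr rfl (fun s' _ => ?_)
  ring

/-- Consequence of Theorem 1: a single soft Bellman iterate applied to an arbitrary
function `Q` is within `(γ/(1−γ))·‖Δ_Q‖_∞` of the optimal value function. -/
theorem single_iterate_close_to_optimal
    {S A : Type*} [Fintype S] [Fintype A] [Nonempty S] [Nonempty A]
    (p : S → A → PMF S) (r : S → A → ℝ) (γ β : ℝ) (π0 : S → PMF A)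
    (hγ0 : 0 ≤ γ) (hγ1 : γ < 1) (hβ : 0 < β)
    (hπ0 : ∀ s a, 0 < π0 s a)
    (Qstar : S → A → ℝ) (hfix : softBellman p r γ β π0 Qstar = Qstar)
    (Q : S → A → ℝ) :
    ∀ s a,
      |Qstar s a - softBellman p r γ β π0 Q s a| ≤
        (γ / (1 - γ)) * ⨆ x : S × A, |softDelta p r γ β π0 Q x.1 x.2| := by
  obtain ⟨x0, hx0⟩ := Finite.exists_max (fun x : S × A => |Qstar x.1 x.2 - Q x.1 x.2|)
  set D := |Qstar x0.1 x0.2 - Q x0.1 x0.2| with hD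
  set M := ⨆ x : S × A, |softDelta p r γ β π0 Q x.1 x.2| with hM
  have hD' : ∀ s a, |Qstar s a - Q s a| ≤ D := fun s a => hx0 (s, a)
  have hMle : ∀ s a, |softDelta p r γ β π0 Q s a| ≤ M := fun s a =>
    le_ciSup (f := fun x : S × A => |softDelta p r γ β π0 Q x.1 x.2|)
      (Set.finite_range _).bddAbove (s, a)
  have key : ∀ s a, |Qstar s a - softBellman p r γ β π0 Q s a| ≤ γ * D := by
    intro s a
    have h1 := softBellman_le p r γ β π0 hγ0 hβ hπ0 Qstar Q D
      (fun s a => by linarith [(abs_le.1 (hD' s a)).2]) s a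
    have h2 := softBellman_le p r γ β π0 hγ0 hβ hπ0 Q Qstar D
      (fun s a => by linarith [(abs_le.1 (hD' s a)).1]) s a
    rw [hfix] at h1 h2
    exact abs_le.2 ⟨by linarith, by linarith⟩
  have hDM : D ≤ γ * D + M := by
    have h1 := key x0.1 x0.2
    have h2 := hMle x0.1 x0.2
    rw [softDelta_eq] at h2
    have h3 := abs_sub_le (Qstar x0.1 x0.2) (softBellman p r γ β π0 Q x0.1 x0.2) (Q x0.1 x0.2)
    linarith
  have h1γ : 0 < 1 - γ := by linarith
  have hDle : D ≤ M / (1 - γ) := by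
    rw [le_div_iff₀ h1γ]
    linarith
  intro s a
  calc _ ≤ γ * D := key s a
    _ ≤ γ * (M / (1 - γ)) := mul_le_mul_of_nonneg_left hDle hγ0
    _ = _ := by ring
end

section
/- (Proposition 1, contraction part) Let L, U : S → A → ℝ satisfy L(s,a) ≤ Q*(s,a) ≤ U(s,a) for all (s,a), and define the clipped Bellman operator B_C by (B_C Q)(s,a) = max( min( (B Q)(s,a), U(s,a) ), L(s,a) ). Then for every Q : S → A → ℝ, sup_{(s,a)} |(B_C Q)(s,a) − Q*(s,a)| ≤ γ · sup_{(s,a)} |Q(s,a) − Q*(s,a)|. -/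
open Real

/-- The clipped soft Bellman operator with lower bound `L` and upper bound `U`. -/
noncomputable def clippedBellman {S A : Type*} [Fintype S] [Fintype A]
    (p : S → A → PMF S) (r : S → A → ℝ) (γ β : ℝ) (π0 : S → PMF A)
    (L U : S → A → ℝ) (Q : S → A → ℝ) : S → A → ℝ :=
  fun s a => max (min (softBellman p r γ β π0 Q s a) (U s a)) (L s a)

theorem pmf_sum_toReal_aux {S : Type*} [Fintype S] (q : PMF S) :
    ∑ s : S, (q s).toReal = 1 := by
  rw [← ENNReal.toReal_sum (fun s _ => q.apply_ne_top s), ← tsum_fintype (L := .unconditional S), q.tsum_coe]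
  simp

theorem softBellman_le_aux {S A : Type*} [Fintype S] [Fintype A] [Nonempty A]
    (p : S → A → PMF S) (r : S → A → ℝ) (γ β : ℝ) (π0 : S → PMF A)
    (hγ0 : 0 ≤ γ) (hβ : 0 < β) (hπ0 : ∀ s a, 0 < π0 s a)
    (Q Q' : S → A → ℝ) (M : ℝ) (h : ∀ s a, Q s a ≤ Q' s a + M) (s : S) (a : A) :
    softBellman p r γ β π0 Q s a ≤ softBellman p r γ β π0 Q' s a + γ * M := by
  have hpos : ∀ s a, 0 < (π0 s a).toReal := fun s a =>
    ENNReal.toReal_pos (hπ0 s a).ne' ((π0 s).apply_ne_top a)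
  have hZ : ∀ (Q : S → A → ℝ) (s : S),
      0 < ∑ a' : A, (π0 s a').toReal * Real.exp (β * Q s a') := fun Q s =>
    Finset.sum_pos (fun a _ => mul_pos (hpos s a) (Real.exp_pos _)) Finset.univ_nonempty
  have hlog : ∀ s, Real.log (∑ a' : A, (π0 s a').toReal * Real.exp (β * Q s a')) ≤
      Real.log (∑ a' : A, (π0 s a').toReal * Real.exp (β * Q' s a')) + β * M := by
    intro s
    rw [← Real.log_exp (β * M), ← Real.log_mul (hZ Q' s).ne' (Real.exp_pos _).ne']
    apply Real.log_le_log (hZ Q s)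
    rw [Finset.sum_mul]
    apply Finset.sum_le_sum
    intro a _
    rw [mul_assoc, ← Real.exp_add]
    apply mul_le_mul_of_nonneg_left _ (hpos s a).le
    apply Real.exp_le_exp.mpr
    nlinarith [h s a]
  have hsum : ∑ s' : S, (p s a s').toReal *
      Real.log (∑ a' : A, (π0 s' a').toReal * Real.exp (β * Q s' a')) ≤
      (∑ s' : S, (p s a s').toReal *
      Real.log (∑ a' : A, (π0 s' a').toReal * Real.exp (β * Q' s' a'))) + β * M := by
    calc _ ≤ ∑ s' : S, (p s a s').toReal *
          (Real.log (∑ a' : A, (π0 s' a').toReal * Real.exp (β * Q' s' a')) + β * M) :=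
          Finset.sum_le_sum fun s' _ => mul_le_mul_of_nonneg_left (hlog s') ENNReal.toReal_nonneg
      _ = _ := by
          simp only [mul_add, Finset.sum_add_distrib]
          rw [← Finset.sum_mul, pmf_sum_toReal_aux, one_mul]
  have h2 := mul_le_mul_of_nonneg_left hsum (div_nonneg hγ0 hβ.le)
  have h3 : γ / β * (β * M) = γ * M := by field_simp
  unfold softBellman
  rw [mul_add, h3] at h2
  linarith

/-- Proposition 1 (contraction part): if `L ≤ Q* ≤ U`, then the clipped Bellman
operator contracts towards `Q*` with rate `γ` in sup norm. -/
theorem clippedBellman_contraction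
    {S A : Type*} [Fintype S] [Fintype A] [Nonempty S] [Nonempty A]
    (p : S → A → PMF S) (r : S → A → ℝ) (γ β : ℝ) (π0 : S → PMF A)
    (hγ0 : 0 ≤ γ) (hγ1 : γ < 1) (hβ : 0 < β)
    (hπ0 : ∀ s a, 0 < π0 s a)
    (Qstar : S → A → ℝ) (hfix : softBellman p r γ β π0 Qstar = Qstar)
    (L U : S → A → ℝ)
    (hL : ∀ s a, L s a ≤ Qstar s a) (hU : ∀ s a, Qstar s a ≤ U s a)
    (Q : S → A → ℝ) :
    (⨆ x : S × A, |clippedBellman p r γ β π0 L U Q x.1 x.2 - Qstar x.1 x.2|) ≤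
      γ * ⨆ x : S × A, |Q x.1 x.2 - Qstar x.1 x.2| := by
  have hb : ∀ s a, |Q s a - Qstar s a| ≤ ⨆ x : S × A, |Q x.1 x.2 - Qstar x.1 x.2| :=
    fun s a => le_ciSup (f := fun x : S × A => |Q x.1 x.2 - Qstar x.1 x.2|)
      (Set.finite_range _).bddAbove (s, a)
  generalize (⨆ x : S × A, |Q x.1 x.2 - Qstar x.1 x.2|) = M at hb ⊢
  apply ciSup_le
  rintro ⟨s, a⟩
  have hM : 0 ≤ M := le_trans (abs_nonneg _) (hb s a)
  have hγM : 0 ≤ γ * M := mul_nonneg hγ0 hM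
  have h1 := softBellman_le_aux p r γ β π0 hγ0 hβ hπ0 Q Qstar M
    (fun s a => by linarith [(abs_le.mp (hb s a)).2]) s a
  have h2 := softBellman_le_aux p r γ β π0 hγ0 hβ hπ0 Qstar Q M
    (fun s a => by linarith [(abs_le.mp (hb s a)).1]) s a
  rw [hfix] at h1 h2
  have hl := hL s a
  have hu := hU s a
  simp only [clippedBellman]
  rw [abs_le]
  constructor
  · have : Qstar s a - γ * M ≤ min (softBellman p r γ β π0 Q s a) (U s a) :=
      le_min (by linarith) (by linarith)
    linarith [le_max_left (min (softBellman p r γ β π0 Q s a) (U s a)) (L s a)]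
  · have : max (min (softBellman p r γ β π0 Q s a) (U s a)) (L s a) ≤ Qstar s a + γ * M :=
      max_le ((min_le_left _ _).trans h1) (by linarith)
    linarith
end
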